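/- It holds that Σ_{j=1}^k w_j Φ(f(A_j)) − exp(B_U) ≤ ( max_{x ∈ S_U} (x − e^x) )·1_K, and Σ_{j=1}^k w_j Φ(f(A_j)) − exp(B_L) ≥ ( min_{x ∈ S_L} (x − e^x) )·1_K, in the Loewner order, where exp is applied to B_U and B_L via continuous functional calculus and 1_K is the identity operator on K. -/

import Mathlib

open ContinuousLinearMap in
/-- The Kantorovich constant `K(m', M', r)`, with the convention that it equals `1`
for `r = 0` and `r = 1`. -/
noncomputable def kantorovich (m M r : ℝ) : ℝ :=
  if r = 0 ∨ r = 1 then 1 else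
    ((m * M ^ r - M * m ^ r) / ((r - 1) * (M - m))) *
      (((r - 1) * (M ^ r - m ^ r)) / (r * (m * M ^ r - M * m ^ r))) ^ r

open ContinuousLinearMap Polynomial

/-- The Kantorovich constant with a natural exponent is at least `1`. -/
lemma one_le_kantorovich_natCast {m M : ℝ} (hm : 0 < m) (hmM : m < M) (n : ℕ) :
    1 ≤ kantorovich m M (n : ℝ) := by
  unfold kantorovich
  split_ifs with h
  · exact le_rfl
  · push Not at h
    have hn1 : n ≠ 1 := fun h1 => h.2 (by simp [h1])
    have hn0 : n ≠ 0 := fun h0 => h.1 (by simp [h0])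
    have hn : 2 ≤ n := by omega
    have hn' : (2 : ℝ) ≤ n := by exact_mod_cast hn
    have hM : 0 < M := hm.trans hmM
    simp only [Real.rpow_natCast]
    have hP : 0 < m * M ^ n - M * m ^ n := by
      obtain ⟨l, rfl⟩ : ∃ l, n = l + 1 := ⟨n - 1, by omega⟩
      have h1 : m ^ l < M ^ l := pow_lt_pow_left₀ hmM hm.le (by omega)
      have h2 : m * M ^ (l + 1) - M * m ^ (l + 1) = m * M * (M ^ l - m ^ l) := by ring
      rw [h2]
      exact mul_pos (mul_pos hm hM) (sub_pos.2 h1)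
    have hQ : 0 < M ^ n - m ^ n := sub_pos.2 (pow_lt_pow_left₀ hmM hm.le hn0)
    have hD : 0 < M - m := sub_pos.2 hmM
    have hn2 : 0 < (n : ℝ) - 1 := by linarith
    have hn3 : 0 < (n : ℝ) := by linarith
    -- the chord of `x ^ n` over `[m, M]` at `m`, bounded by Bernoulli's inequality
    set P := m * M ^ n - M * m ^ n with hPdef
    set Q := M ^ n - m ^ n with hQdef
    have ht : 0 < m * (((n : ℝ) - 1) * Q / (n * P)) := by positivity
    have hb := one_add_mul_sub_le_pow
      (show -1 ≤ m * (((n : ℝ) - 1) * Q / (n * P)) by linarith) n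
    have hchord : P / (((n : ℝ) - 1) * (M - m)) *
        (1 + n * (m * (((n : ℝ) - 1) * Q / (n * P)) - 1)) = m ^ n := by
      have hmn : m * Q - P = (M - m) * m ^ n := by rw [hPdef, hQdef]; ring
      have : P / (((n : ℝ) - 1) * (M - m)) *
        (1 + n * (m * (((n : ℝ) - 1) * Q / (n * P)) - 1)) = (m * Q - P) / (M - m) := by
        field_simp
        ring
      rw [this, hmn]
      field_simp
    have hle := mul_le_mul_of_nonneg_left hb
      (show 0 ≤ P / (((n : ℝ) - 1) * (M - m)) by positivity)
    rw [hchord, mul_pow] at hle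
    have hmn : 0 < m ^ n := pow_pos hm n
    refine le_of_mul_le_mul_left ?_ hmn
    linarith

section Compression

variable {H K : Type*} [NormedAddCommGroup H] [InnerProductSpace ℂ H] [CompleteSpace H]
  [NormedAddCommGroup K] [InnerProductSpace ℂ K] [CompleteSpace K]

lemma sum_smul_compression_mono {k : ℕ} (V : K →L[ℂ] H) {w : Fin k → ℝ} (hw : ∀ j, 0 ≤ w j)
    {X Y : Fin k → H →L[ℂ] H} (h : ∀ j, X j ≤ Y j) :
    ∑ j, w j • ((adjoint V) ∘L X j ∘L V) ≤ ∑ j, w j • ((adjoint V) ∘L Y j ∘L V) := by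
  refine Finset.sum_le_sum fun j _ => smul_le_smul_of_nonneg_left ?_ (hw j)
  rw [le_def]
  have := ((le_def _ _).1 (h j)).adjoint_conj V
  simpa [ContinuousLinearMap.sub_comp, ContinuousLinearMap.comp_sub] using this

lemma sum_smul_compression_algebraMap {k : ℕ} {V : K →L[ℂ] H} (hV : (adjoint V) ∘L V = 1)
    {w : Fin k → ℝ} (hw1 : ∑ j, w j = 1) (c : ℝ) :
    ∑ j, w j • ((adjoint V) ∘L (algebraMap ℝ (H →L[ℂ] H) c) ∘L V) =
      algebraMap ℝ (K →L[ℂ] K) c := by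
  have h : (adjoint V) ∘L (algebraMap ℝ (H →L[ℂ] H) c) ∘L V = algebraMap ℝ (K →L[ℂ] K) c := by
    rw [Algebra.algebraMap_eq_smul_one, Algebra.algebraMap_eq_smul_one, ← hV]
    ext x
    simp
  rw [h, ← Finset.sum_smul, hw1, one_smul]

lemma isSelfAdjoint_sum_smul_compression {k : ℕ} (V : K →L[ℂ] H) (w : Fin k → ℝ)
    {X : Fin k → H →L[ℂ] H} (hX : ∀ j, IsSelfAdjoint (X j)) :
    IsSelfAdjoint (∑ j, w j • ((adjoint V) ∘L X j ∘L V)) := by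
  refine isSelfAdjoint_sum _ fun j _ => ?_
  exact IsSelfAdjoint.smul (IsSelfAdjoint.all (w j)) ((hX j).adjoint_conj V)

/-- A convex combination of compressions of self-adjoint operators with spectra in a compact
convex set has its spectrum in that set. -/
lemma spectrum_sum_smul_compression_subset {k : ℕ} {V : K →L[ℂ] H} (hV : (adjoint V) ∘L V = 1)
    {w : Fin k → ℝ} (hw : ∀ j, 0 ≤ w j) (hw1 : ∑ j, w j = 1)
    {X : Fin k → H →L[ℂ] H} (hX : ∀ j, IsSelfAdjoint (X j)) {S : Set ℝ} (hSc : IsCompact S)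
    (hSconv : Convex ℝ S) (hSne : S.Nonempty) (hXS : ∀ j, spectrum ℝ (X j) ⊆ S) :
    spectrum ℝ (∑ j, w j • ((adjoint V) ∘L X j ∘L V)) ⊆ S := by
  obtain ⟨c, hc⟩ := hSc.exists_isLeast hSne
  obtain ⟨d, hd⟩ := hSc.exists_isGreatest hSne
  have hsa := isSelfAdjoint_sum_smul_compression V w hX
  have hl := sum_smul_compression_mono V hw fun j =>
    algebraMap_le_of_le_spectrum (ha := hX j) fun x hx => hc.2 (hXS j hx)
  have hu := sum_smul_compression_mono V hw fun j =>
    le_algebraMap_of_spectrum_le (ha := hX j) fun x hx => hd.2 (hXS j hx)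
  rw [sum_smul_compression_algebraMap hV hw1] at hl hu
  intro x hx
  exact hSconv.ordConnected.out hc.1 hd.1
    ⟨(algebraMap_le_iff_le_spectrum (ha := hsa)).1 hl x hx,
      (le_algebraMap_iff_spectrum_le (ha := hsa)).1 hu x hx⟩

lemma sub_cfc_exp_le {B : K →L[ℂ] K} (hB : IsSelfAdjoint B) {S : Set ℝ} (hS : IsCompact S)
    (hBS : spectrum ℝ B ⊆ S) :
    B - cfc Real.exp B ≤ (sSup ((fun x => x - Real.exp x) '' S)) • (1 : K →L[ℂ] K) ∧
    (sInf ((fun x => x - Real.exp x) '' S)) • (1 : K →L[ℂ] K) ≤ B - cfc Real.exp B := by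
  have hcont : Continuous fun x : ℝ => x - Real.exp x := by fun_prop
  have hcomp := hS.image hcont
  have heq : B - cfc Real.exp B = cfc (fun x => x - Real.exp x) B := by
    rw [cfc_sub (fun x : ℝ => x) Real.exp B, cfc_id' ℝ B]
  rw [heq, ← Algebra.algebraMap_eq_smul_one, ← Algebra.algebraMap_eq_smul_one]
  exact ⟨cfc_le_algebraMap _ _ B fun x hx => le_csSup hcomp.bddAbove ⟨x, hBS hx, rfl⟩,
    algebraMap_le_cfc _ _ B fun x hx => csInf_le hcomp.bddBelow ⟨x, hBS hx, rfl⟩⟩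

/-- The difference between a convex combination of compressions of `q j (A j)` and its exponential
is bounded by the extrema of `x - exp x` over the closed convex hull of the ranges of the `q j`. -/
lemma compression_sub_cfc_exp_le {k : ℕ} (hk : 1 ≤ k) {V : K →L[ℂ] H}
    (hV : (adjoint V) ∘L V = 1) {w : Fin k → ℝ} (hw : ∀ j, 0 ≤ w j) (hw1 : ∑ j, w j = 1)
    {m M : Fin k → ℝ} (hmM : ∀ j, m j < M j) {A : Fin k → H →L[ℂ] H}
    (hA : ∀ j, IsSelfAdjoint (A j)) (hspec : ∀ j, spectrum ℝ (A j) ⊆ Set.Icc (m j) (M j))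
    {q : Fin k → ℝ → ℝ} (hq : ∀ j, Continuous (q j)) :
    (∑ j, w j • ((adjoint V) ∘L (cfc (q j) (A j)) ∘L V)) -
        cfc Real.exp (∑ j, w j • ((adjoint V) ∘L (cfc (q j) (A j)) ∘L V)) ≤
      (sSup ((fun x => x - Real.exp x) ''
        closure (convexHull ℝ (⋃ j, q j '' Set.Icc (m j) (M j))))) • (1 : K →L[ℂ] K) ∧
    (sInf ((fun x => x - Real.exp x) ''
        closure (convexHull ℝ (⋃ j, q j '' Set.Icc (m j) (M j))))) • (1 : K →L[ℂ] K) ≤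
      (∑ j, w j • ((adjoint V) ∘L (cfc (q j) (A j)) ∘L V)) -
        cfc Real.exp (∑ j, w j • ((adjoint V) ∘L (cfc (q j) (A j)) ∘L V)) := by
  have hU : IsCompact (⋃ j, q j '' Set.Icc (m j) (M j)) :=
    isCompact_iUnion fun j => isCompact_Icc.image (hq j)
  have hsub : (⋃ j, q j '' Set.Icc (m j) (M j)) ⊆
      closure (convexHull ℝ (⋃ j, q j '' Set.Icc (m j) (M j))) :=
    (subset_convexHull ℝ _).trans subset_closure
  have hS : IsCompact (closure (convexHull ℝ (⋃ j, q j '' Set.Icc (m j) (M j)))) :=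
    (isBounded_convexHull.2 hU.isBounded).isCompact_closure
  have hne : (closure (convexHull ℝ (⋃ j, q j '' Set.Icc (m j) (M j)))).Nonempty :=
    ⟨_, hsub (Set.mem_iUnion.2 ⟨⟨0, hk⟩, _, Set.left_mem_Icc.2 (hmM _).le, rfl⟩)⟩
  have hX : ∀ j, IsSelfAdjoint (cfc (q j) (A j)) := fun j => cfc_predicate _ _
  refine sub_cfc_exp_le (isSelfAdjoint_sum_smul_compression V w hX) hS
    (spectrum_sum_smul_compression_subset hV hw hw1 hX hS (convex_convexHull ℝ _).closure hne
      fun j => ?_)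
  rw [cfc_map_spectrum (q j) (A j) (ha := hA j) (hf := (hq j).continuousOn)]
  rintro _ ⟨x, hx, rfl⟩
  exact hsub (Set.mem_iUnion.2 ⟨j, x, hspec j hx, rfl⟩)

end Compression

lemma sum_smul_cfc_pow {H : Type*} [NormedAddCommGroup H] [InnerProductSpace ℂ H]
    [CompleteSpace H] {A : H →L[ℂ] H} (hA : IsSelfAdjoint A) {f : ℝ → ℝ}
    (hf : ContinuousOn f (spectrum ℝ A)) (s : Finset ℕ) (a : ℕ → ℝ) :
    ∑ i ∈ s, a i • (cfc f A) ^ i = cfc (fun x => ∑ i ∈ s, a i * f x ^ i) A := by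
  have h := cfc_sum (fun i x => a i * f x ^ i) A s fun i _ => by fun_prop
  have hs : (∑ i ∈ s, fun x => a i * f x ^ i) = fun x => ∑ i ∈ s, a i * f x ^ i := by
    ext x; simp
  rw [← hs, h]
  refine Finset.sum_congr rfl fun i _ => ?_
  rw [cfc_const_mul (a i) (fun x => f x ^ i) A (by fun_prop), cfc_pow f i A hf hA]

lemma sum_mul_pow_bounds {a : ℕ → ℝ} {s : Finset ℕ} {l y u : ℝ} (hl : 0 < l) (hly : l ≤ y)
    (hyu : y ≤ u) {κU κL : ℕ → ℝ} (hκU : ∀ i, 1 ≤ κU i) (hκL : ∀ i, 1 ≤ κL i) :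
    ∑ i ∈ s, a i * y ^ i ≤ (∑ i ∈ s.filter (fun i => 0 ≤ a i), a i * κU i * u ^ i) +
        ∑ i ∈ s.filter (fun i => a i < 0), a i * (κL i)⁻¹ * l ^ i ∧
    (∑ i ∈ s.filter (fun i => 0 ≤ a i), a i * (κL i)⁻¹ * l ^ i) +
        ∑ i ∈ s.filter (fun i => a i < 0), a i * κU i * u ^ i ≤ ∑ i ∈ s, a i * y ^ i := by
  have hy : 0 < y := hl.trans_le hly
  have hup : ∀ i, y ^ i ≤ κU i * u ^ i := fun i =>
    (pow_le_pow_left₀ hy.le hyu i).trans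
      (le_mul_of_one_le_left (pow_nonneg (hy.le.trans hyu) i) (hκU i))
  have hlo : ∀ i, (κL i)⁻¹ * l ^ i ≤ y ^ i := fun i =>
    (mul_le_of_le_one_left (pow_nonneg hl.le i) (inv_le_one_of_one_le₀ (hκL i))).trans
      (pow_le_pow_left₀ hl.le hly i)
  have hsplit : ∑ i ∈ s, a i * y ^ i = (∑ i ∈ s.filter (fun i => 0 ≤ a i), a i * y ^ i) +
      ∑ i ∈ s.filter (fun i => a i < 0), a i * y ^ i := by
    rw [← Finset.sum_filter_add_sum_filter_not s (fun i => 0 ≤ a i)]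
    simp only [not_le]
  simp only [hsplit, mul_assoc]
  constructor <;> refine add_le_add (Finset.sum_le_sum fun i hi => ?_)
    (Finset.sum_le_sum fun i hi => ?_)
  · exact mul_le_mul_of_nonneg_left (hup i) (Finset.mem_filter.1 hi).2
  · exact mul_le_mul_of_nonpos_left (hlo i) (Finset.mem_filter.1 hi).2.le
  · exact mul_le_mul_of_nonneg_left (hlo i) (Finset.mem_filter.1 hi).2
  · exact mul_le_mul_of_nonpos_left (hup i) (Finset.mem_filter.1 hi).2.le

lemma sInf_eval_image_Icc_pos {p : Polynomial ℝ} {m M : ℝ} (hmM : m < M)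
    (hp : ∀ x ∈ Set.Icc m M, 0 < p.eval x) :
    0 < sInf ((fun x => p.eval x) '' Set.Icc m M) := by
  obtain ⟨x, hx, hxe⟩ := (isCompact_Icc.image p.continuous).sInf_mem
    ((Set.nonempty_Icc.2 hmM.le).image _)
  exact hxe ▸ hp x hx

theorem stmt18
    {H K : Type*} [NormedAddCommGroup H] [InnerProductSpace ℂ H] [CompleteSpace H]
    [NormedAddCommGroup K] [InnerProductSpace ℂ K] [CompleteSpace K]
    (V : K →L[ℂ] H) (hV : (adjoint V) ∘L V = 1)
    (I : ℕ) (a : ℕ → ℝ)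
    (k : ℕ) (hk : 1 ≤ k)
    (w : Fin k → ℝ) (hw : ∀ j, 0 ≤ w j) (hw1 : ∑ j, w j = 1)
    (m M : Fin k → ℝ) (hmM : ∀ j, m j < M j)
    (A : Fin k → H →L[ℂ] H) (hA : ∀ j, IsSelfAdjoint (A j))
    (hspec : ∀ j, spectrum ℝ (A j) ⊆ Set.Icc (m j) (M j))
    (f : ℝ → ℝ) (hf : ContinuousOn f (⋃ j, Set.Icc (m j) (M j)))
    (pL pU : Polynomial ℝ)
    (hp : ∀ x ∈ ⋃ j, Set.Icc (m j) (M j),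
      0 < pL.eval x ∧ pL.eval x ≤ f x ∧ f x ≤ pU.eval x)
    (mU MU mL ML : Fin k → ℝ)
    (hmU : ∀ j, mU j = sInf ((fun x => pU.eval x) '' Set.Icc (m j) (M j)))
    (hMU : ∀ j, MU j = sSup ((fun x => pU.eval x) '' Set.Icc (m j) (M j)))
    (hmL : ∀ j, mL j = sInf ((fun x => pL.eval x) '' Set.Icc (m j) (M j)))
    (hML : ∀ j, ML j = sSup ((fun x => pL.eval x) '' Set.Icc (m j) (M j)))
    (hUlt : ∀ j, mU j < MU j) (hLlt : ∀ j, mL j < ML j)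
    (qU qL : Fin k → ℝ → ℝ)
    (hqU : ∀ j x, qU j x =
      (∑ i ∈ (Finset.range (I + 1)).filter (fun i => 0 ≤ a i),
        a i * kantorovich (mU j) (MU j) (i : ℝ) * (pU.eval x) ^ i) +
      ∑ i ∈ (Finset.range (I + 1)).filter (fun i => a i < 0),
        a i * (kantorovich (mL j) (ML j) (i : ℝ))⁻¹ * (pL.eval x) ^ i)
    (hqL : ∀ j x, qL j x =
      (∑ i ∈ (Finset.range (I + 1)).filter (fun i => 0 ≤ a i),
        a i * (kantorovich (mL j) (ML j) (i : ℝ))⁻¹ * (pL.eval x) ^ i) +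
      ∑ i ∈ (Finset.range (I + 1)).filter (fun i => a i < 0),
        a i * kantorovich (mU j) (MU j) (i : ℝ) * (pU.eval x) ^ i)
    (BU BL : K →L[ℂ] K)
    (hBU : BU = ∑ j, w j • ((adjoint V) ∘L (cfc (qU j) (A j)) ∘L V))
    (hBL : BL = ∑ j, w j • ((adjoint V) ∘L (cfc (qL j) (A j)) ∘L V))
    (SU SL : Set ℝ)
    (hSU : SU = closure (convexHull ℝ (⋃ j, qU j '' Set.Icc (m j) (M j))))
    (hSL : SL = closure (convexHull ℝ (⋃ j, qL j '' Set.Icc (m j) (M j)))) :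
    ((∑ j, w j • ((adjoint V) ∘L (∑ i ∈ Finset.range (I + 1), a i • (cfc f (A j)) ^ i) ∘L V)) - cfc Real.exp BU ≤
      (sSup ((fun x => x - Real.exp x) '' SU)) • (1 : K →L[ℂ] K)) ∧
    (sInf ((fun x => x - Real.exp x) '' SL)) • (1 : K →L[ℂ] K) ≤
      (∑ j, w j • ((adjoint V) ∘L (∑ i ∈ Finset.range (I + 1), a i • (cfc f (A j)) ^ i) ∘L V)) - cfc Real.exp BL := by
  have hmem : ∀ j, ∀ x ∈ Set.Icc (m j) (M j), x ∈ ⋃ j, Set.Icc (m j) (M j) :=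
    fun j x hx => Set.mem_iUnion.2 ⟨j, hx⟩
  have hκU : ∀ (j : Fin k) (i : ℕ), 1 ≤ kantorovich (mU j) (MU j) (i : ℝ) := fun j i =>
    one_le_kantorovich_natCast (hmU j ▸ sInf_eval_image_Icc_pos (hmM j) fun x hx =>
      have h := hp x (hmem j x hx)
      h.1.trans_le (h.2.1.trans h.2.2)) (hUlt j) i
  have hκL : ∀ (j : Fin k) (i : ℕ), 1 ≤ kantorovich (mL j) (ML j) (i : ℝ) := fun j i =>
    one_le_kantorovich_natCast (hmL j ▸ sInf_eval_image_Icc_pos (hmM j) fun x hx =>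
      (hp x (hmem j x hx)).1) (hLlt j) i
  have hqUc : ∀ j, Continuous (qU j) := fun j => by
    rw [funext (hqU j)]; fun_prop
  have hqLc : ∀ j, Continuous (qL j) := fun j => by
    rw [funext (hqL j)]; fun_prop
  have hfc : ∀ j, ContinuousOn f (spectrum ℝ (A j)) := fun j =>
    hf.mono fun x hx => hmem j x (hspec j hx)
  have hbound : ∀ j, ∀ x ∈ spectrum ℝ (A j),
      ∑ i ∈ Finset.range (I + 1), a i * f x ^ i ≤ qU j x ∧
      qL j x ≤ ∑ i ∈ Finset.range (I + 1), a i * f x ^ i := fun j x hx => by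
    obtain ⟨h0, h1, h2⟩ := hp x (hmem j x (hspec j hx))
    rw [hqU, hqL]
    exact sum_mul_pow_bounds h0 h1 h2 (hκU j) (hκL j)
  have hΦc : ∀ j, ContinuousOn (fun x => ∑ i ∈ Finset.range (I + 1), a i * f x ^ i)
      (spectrum ℝ (A j)) := fun j => by
    have := hfc j
    fun_prop
  have hupper := sum_smul_compression_mono V hw fun j =>
    cfc_mono (fun x hx => (hbound j x hx).1) (hΦc j) (hqUc j).continuousOn
  have hlower := sum_smul_compression_mono V hw fun j =>
    cfc_mono (fun x hx => (hbound j x hx).2) (hqLc j).continuousOn (hΦc j)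
  simp only [fun j => sum_smul_cfc_pow (hA j) (hfc j)]
  subst hBU hBL hSU hSL
  exact ⟨(sub_le_sub_right hupper _).trans
      (compression_sub_cfc_exp_le hk hV hw hw1 hmM hA hspec hqUc).1,
    (compression_sub_cfc_exp_le hk hV hw hw1 hmM hA hspec hqLc).2.trans
      (sub_le_sub_right hlower _)⟩
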